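/- arXiv:1207.1015 — 5 statements merged into one kernel-verified Lean document; each statement's English description precedes it below -/
import Mathlib

section
/- Assume char k ≠ 2. The map χ : T → U defined by χ(a₁, a₂, t) := ((a₁, star a₂), (β • (a₂ * star a₂) − t, −(a₁ * star a₂))) is a bijection from T onto U and satisfies χ(s · s') = χ(s) + χ(s') for all s, s' ∈ T; i.e., χ is a group isomorphism from the hermitian group T onto the root group U. (This is part (ii) of the paper's theorem on polarities of type III.) -/
noncomputable section

open Quaternion

/-- Multiplication of the Cayley–Dickson double `O = D × D` of the quaternion algebra `D`. -/
def omul {k : Type*} [Field k] {c₁ c₂ : k} (β : k)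
    (x y : ℍ[k,c₁,c₂] × ℍ[k,c₁,c₂]) : ℍ[k,c₁,c₂] × ℍ[k,c₁,c₂] :=
  (x.1 * y.1 - β • (y.2 * star x.2), y.1 * x.2 + star x.1 * y.2)

/-- Conjugation of the Cayley–Dickson double. -/
def oconj {k : Type*} [Field k] {c₁ c₂ : k}
    (x : ℍ[k,c₁,c₂] × ℍ[k,c₁,c₂]) : ℍ[k,c₁,c₂] × ℍ[k,c₁,c₂] :=
  (star x.1, -x.2)

/-- The automorphism of `O` corresponding to a polarity of type III. -/
def ηIII {k : Type*} [Field k] {c₁ c₂ : k}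
    (x : ℍ[k,c₁,c₂] × ℍ[k,c₁,c₂]) : ℍ[k,c₁,c₂] × ℍ[k,c₁,c₂] :=
  (x.1, -x.2)

/-- The hermitian group `T`. -/
def Tset {k : Type*} [Field k] (c₁ c₂ β : k) :
    Set (ℍ[k,c₁,c₂] × ℍ[k,c₁,c₂] × ℍ[k,c₁,c₂]) :=
  {s | star s.1 * s.1 + β • (star s.2.1 * s.2.1) = s.2.2 + star s.2.2}

/-- The group operation on `T`. -/
def Tmul {k : Type*} [Field k] {c₁ c₂ : k} (β : k)
    (s s' : ℍ[k,c₁,c₂] × ℍ[k,c₁,c₂] × ℍ[k,c₁,c₂]) :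
    ℍ[k,c₁,c₂] × ℍ[k,c₁,c₂] × ℍ[k,c₁,c₂] :=
  (s.1 + s'.1, s.2.1 + s'.2.1,
    s.2.2 + s'.2.2 + star s'.1 * s.1 + β • (star s'.2.1 * s.2.1))

/-- The root group `U` coming from the polarity of type III. -/
def Uset {k : Type*} [Field k] (c₁ c₂ β : k) :
    Set ((ℍ[k,c₁,c₂] × ℍ[k,c₁,c₂]) × (ℍ[k,c₁,c₂] × ℍ[k,c₁,c₂])) :=
  {u | omul β (ηIII (oconj u.1)) u.1 + ηIII (oconj u.2) + u.2 = 0}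

/-- The group operation on `U`. -/
def Uadd {k : Type*} [Field k] {c₁ c₂ : k} (β : k)
    (u v : (ℍ[k,c₁,c₂] × ℍ[k,c₁,c₂]) × (ℍ[k,c₁,c₂] × ℍ[k,c₁,c₂])) :
    (ℍ[k,c₁,c₂] × ℍ[k,c₁,c₂]) × (ℍ[k,c₁,c₂] × ℍ[k,c₁,c₂]) :=
  (u.1 + v.1, u.2 + v.2 - omul β (ηIII (oconj v.1)) u.1)

/-- The map `χ : T → U`. -/
def χmap {k : Type*} [Field k] {c₁ c₂ : k} (β : k)
    (s : ℍ[k,c₁,c₂] × ℍ[k,c₁,c₂] × ℍ[k,c₁,c₂]) :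
    (ℍ[k,c₁,c₂] × ℍ[k,c₁,c₂]) × (ℍ[k,c₁,c₂] × ℍ[k,c₁,c₂]) :=
  ((s.1, star s.2.1), (β • (s.2.1 * star s.2.1) - s.2.2, -(s.1 * star s.2.1)))

/-- `χ` is a group isomorphism from `T` onto `U`. -/
theorem χ_group_isomorphism {k : Type*} [Field k] (hchar : (2 : k) ≠ 0)
    (c₁ c₂ : k) (β : k) (hβ : β ≠ 0) :
    (∀ s ∈ Tset c₁ c₂ β, χmap β s ∈ Uset c₁ c₂ β) ∧
    (∀ s ∈ Tset c₁ c₂ β, ∀ s' ∈ Tset c₁ c₂ β, χmap β s = χmap β s' → s = s') ∧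
    (∀ u ∈ Uset c₁ c₂ β, ∃ s ∈ Tset c₁ c₂ β, χmap β s = u) ∧
    (∀ s ∈ Tset c₁ c₂ β, ∀ s' ∈ Tset c₁ c₂ β,
      χmap β (Tmul β s s') = Uadd β (χmap β s) (χmap β s')) := by
  refine ⟨?_, ?_, ?_, ?_⟩
  · rintro ⟨a, b, t⟩ h
    simp only [Tset, Uset, χmap, omul, oconj, ηIII, Set.mem_setOf_eq] at h ⊢
    have h0 := congrArg QuaternionAlgebra.re h
    simp at h0
    ext <;> simp
    all_goals first | ring1 | linear_combination h0
  · rintro ⟨a, b, t⟩ - ⟨a', b', t'⟩ - h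
    simp only [χmap, Prod.mk.injEq, star_inj] at h
    obtain ⟨⟨rfl, rfl⟩, h, -⟩ := h
    rw [sub_right_inj] at h
    rw [h]
  · rintro ⟨⟨a, b⟩, ⟨c, d⟩⟩ h
    simp only [Uset, omul, oconj, ηIII, Set.mem_setOf_eq, Prod.mk_add_mk, Prod.mk_eq_zero] at h
    obtain ⟨h1, h2⟩ := h
    have hd : d = -(a * b) := by
      have h3 : (2 : k) • (a * b + d) = 0 := by
        rw [← h2, two_smul]
        simp only [star_star, neg_neg]
        abel
      have h4 := (smul_eq_zero.mp h3).resolve_left hchar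
      exact eq_neg_of_add_eq_zero_right h4
    refine ⟨(a, star b, β • (star b * b) - c), ?_, ?_⟩
    · have h0 := congrArg QuaternionAlgebra.re h1
      simp at h0
      simp only [Tset, Set.mem_setOf_eq]
      ext <;> simp
      all_goals first | ring1 | linear_combination h0
    · simp [χmap, hd]
  · rintro ⟨a, b, t⟩ - ⟨a', b', t'⟩ -
    simp only [χmap, Tmul, Uadd, omul, oconj, ηIII]
    ext <;> simp <;> ring1
end
end

section
/- Let a₁, a₂, t ∈ D satisfy star a₁ * a₁ + β • (star a₂ * a₂) = t + star t. Then star (β • (a₂ * star a₂) − t) * (β • (a₂ * star a₂) − t) + β • (star (a₁ * star a₂) * (a₁ * star a₂)) = star t * t. (Equivalently, in norm notation: N(−t + βN(a₂)) + βN(−a₁·conj a₂) = N(t) whenever N(a₁) + βN(a₂) = T(t); this is the norm identity used in the proof of the theorem on polarities of type III.) -/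
noncomputable section

open Quaternion

/-- the norm identity
`N(-t + βN(a₂)) + βN(-a₁·conj a₂) = N(t)` whenever `N(a₁) + βN(a₂) = T(t)`,
written out with quaternion conjugation. -/
theorem norm_identity {k : Type*} [Field k] (c₁ c₂ : k) (β : k)
    (a₁ a₂ t : ℍ[k,c₁,c₂])
    (h : star a₁ * a₁ + β • (star a₂ * a₂) = t + star t) :
    star (β • (a₂ * star a₂) - t) * (β • (a₂ * star a₂) - t)
      + β • (star (a₁ * star a₂) * (a₁ * star a₂)) = star t * t := by
  have h2 : star a₂ * a₂ = a₂ * star a₂ := star_comm_self' a₂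
  obtain ⟨n, hn⟩ : ∃ n : k, a₂ * star a₂ = (n : ℍ[k,c₁,c₂]) :=
    ⟨_, QuaternionAlgebra.mul_star_eq_coe a₂⟩
  obtain ⟨m, hm⟩ : ∃ m : k, star a₁ * a₁ = (m : ℍ[k,c₁,c₂]) :=
    ⟨_, QuaternionAlgebra.star_mul_eq_coe a₁⟩
  have h3 : star (a₁ * star a₂) * (a₁ * star a₂) = ((m * n : k) : ℍ[k,c₁,c₂]) := by
    rw [star_mul, star_star, mul_assoc, ← mul_assoc (star a₁), hm,
      QuaternionAlgebra.coe_commutes, ← mul_assoc, hn, ← QuaternionAlgebra.coe_mul, mul_comm]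
  rw [h3, hn]
  rw [h2, hn, hm] at h
  have hr := congrArg QuaternionAlgebra.re h
  simp at hr
  ext
  · simp
    linear_combination (β * n) * hr
  all_goals
    simp
    ring
end
end

section
/- The map Ψ is a polarity of the octonion plane P²(O): Ψ sends points to lines and lines to points, Ψ ∘ Ψ is the identity on points and on lines, and for every point p and every line L one has p * L if and only if Ψ(L) * Ψ(p). -/
noncomputable section

open Quaternion

/-- Points of the octonion plane `P²(O)`: `(a,b)`, `(c)` and `(∞)`. -/
inductive OctPoint (O : Type*) where
  | pt : O → O → OctPoint O
  | dir : O → OctPoint O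
  | inf : OctPoint O

/-- Lines of the octonion plane `P²(O)`: `[m,k]`, `[l]` and `[∞]`. -/
inductive OctLine (O : Type*) where
  | ln : O → O → OctLine O
  | vert : O → OctLine O
  | inf : OctLine O

/-- The incidence relation of the octonion plane. -/
def incid {k : Type*} [Field k] {c₁ c₂ : k} (β : k) :
    OctPoint (ℍ[k,c₁,c₂] × ℍ[k,c₁,c₂]) → OctLine (ℍ[k,c₁,c₂] × ℍ[k,c₁,c₂]) → Prop
  | .pt a b, .ln m km => omul β m a + b = km
  | .pt a _, .vert l => a = l
  | .pt _ _, .inf => False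
  | .dir c, .ln m _ => c = m
  | .dir _, .vert _ => False
  | .dir _, .inf => True
  | .inf, .ln _ _ => False
  | .inf, .vert _ => True
  | .inf, .inf => True

/-- The polarity `Ψ` on points. -/
def ΨP {k : Type*} [Field k] {c₁ c₂ : k}
    (η : ℍ[k,c₁,c₂] × ℍ[k,c₁,c₂] → ℍ[k,c₁,c₂] × ℍ[k,c₁,c₂]) :
    OctPoint (ℍ[k,c₁,c₂] × ℍ[k,c₁,c₂]) → OctLine (ℍ[k,c₁,c₂] × ℍ[k,c₁,c₂])
  | .pt a b => .ln (η (oconj a)) (-(η (oconj b)))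
  | .dir c => .vert (η (oconj c))
  | .inf => .inf

/-- The polarity `Ψ` on lines. -/
def ΨL {k : Type*} [Field k] {c₁ c₂ : k}
    (η : ℍ[k,c₁,c₂] × ℍ[k,c₁,c₂] → ℍ[k,c₁,c₂] × ℍ[k,c₁,c₂]) :
    OctLine (ℍ[k,c₁,c₂] × ℍ[k,c₁,c₂]) → OctPoint (ℍ[k,c₁,c₂] × ℍ[k,c₁,c₂])
  | .ln m km => .pt (η (oconj m)) (-(η (oconj km)))
  | .vert l => .dir (η (oconj l))
  | .inf => .inf

theorem oconj_omul_aux {k : Type*} [Field k] {c₁ c₂ : k} (β : k)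
    (x y : ℍ[k,c₁,c₂] × ℍ[k,c₁,c₂]) :
    oconj (omul β x y) = omul β (oconj y) (oconj x) := by
  refine Prod.ext ?_ ?_
  · simp [oconj, omul]
  · simp [oconj, omul]
    try abel

theorem oconj_oconj_aux {k : Type*} [Field k] {c₁ c₂ : k}
    (x : ℍ[k,c₁,c₂] × ℍ[k,c₁,c₂]) : oconj (oconj x) = x := by
  simp [oconj]

theorem oconj_add_aux {k : Type*} [Field k] {c₁ c₂ : k}
    (x y : ℍ[k,c₁,c₂] × ℍ[k,c₁,c₂]) : oconj (x + y) = oconj x + oconj y := by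
  refine Prod.ext ?_ ?_
  · simp [oconj]
  · simp [oconj]
    try abel

/-- `Ψ` is a polarity of the octonion plane. -/
theorem Ψ_is_polarity {k : Type*} [Field k] (c₁ c₂ : k) (β : k) (hβ : β ≠ 0)
    (η : ℍ[k,c₁,c₂] × ℍ[k,c₁,c₂] → ℍ[k,c₁,c₂] × ℍ[k,c₁,c₂])
    (hbij : Function.Bijective η)
    (hadd : ∀ x y, η (x + y) = η x + η y)
    (hmul : ∀ x y, η (omul β x y) = omul β (η x) (η y))
    (hone : η ((1 : ℍ[k,c₁,c₂]), (0 : ℍ[k,c₁,c₂])) = (1, 0))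
    (hinvol : ∀ x, η (η x) = x)
    (hconj : ∀ x, η (oconj x) = oconj (η x)) :
    (∀ p : OctPoint (ℍ[k,c₁,c₂] × ℍ[k,c₁,c₂]), ΨL η (ΨP η p) = p) ∧
    (∀ L : OctLine (ℍ[k,c₁,c₂] × ℍ[k,c₁,c₂]), ΨP η (ΨL η L) = L) ∧
    (∀ (p : OctPoint (ℍ[k,c₁,c₂] × ℍ[k,c₁,c₂]))
       (L : OctLine (ℍ[k,c₁,c₂] × ℍ[k,c₁,c₂])),
      incid β p L ↔ incid β (ΨL η L) (ΨP η p)) := by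
  have s2 : ∀ x, η (oconj (η (oconj x))) = x := fun x => by
    rw [← hconj, hinvol, oconj_oconj_aux]
  have sadd : ∀ x y, η (oconj (x + y)) = η (oconj x) + η (oconj y) := fun x y => by
    rw [oconj_add_aux, hadd]
  have szero : η (oconj 0) = 0 := by simpa using sadd 0 0
  have sneg : ∀ x, η (oconj (-x)) = -η (oconj x) := fun x => by
    have h := sadd (-x) x
    rw [neg_add_cancel, szero] at h
    exact eq_neg_of_add_eq_zero_left h.symm
  have sinj : ∀ x y, η (oconj x) = η (oconj y) ↔ x = y := fun x y =>
    ⟨fun h => by rw [← s2 x, h, s2], fun h => by rw [h]⟩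
  refine ⟨?_, ?_, ?_⟩
  · rintro (⟨a, b⟩ | c | _) <;> simp [ΨP, ΨL, s2, sneg]
  · rintro (⟨a, b⟩ | c | _) <;> simp [ΨP, ΨL, s2, sneg]
  · rintro (⟨a, b⟩ | c | _) (⟨m, l⟩ | l | _) <;> simp only [ΨP, ΨL, incid, sinj]
    · rw [← hmul, ← oconj_omul_aux, ← sinj, sadd]
      rw [← sub_eq_add_neg, sub_eq_iff_eq_add, neg_add_eq_sub, eq_sub_iff_add_eq]
    all_goals exact eq_comm
end
end

section
/- Let A, B, M ∈ O. The map x(A,B,M) commutes with the polarity Ψ — i.e., Ψ(x(A,B,M)(a,b)) = x(A,B,M)(Ψ(a,b)) for all a,b ∈ O and Ψ(x(A,B,M)[m,k]) = x(A,B,M)(Ψ[m,k]) for all m,k ∈ O — if and only if A = η(conj M) and η(conj B) + B + M*A = 0. (This is the paper's identification, in Section 5.1, of which elements of the unipotent radical centralize the polarity.) -/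
noncomputable section

open Quaternion

/-- The action of `x(A,B,M)` on points `(a,b)` of the octonion plane. -/
def xPt {k : Type*} [Field k] {c₁ c₂ : k} (β : k)
    (A B M : ℍ[k,c₁,c₂] × ℍ[k,c₁,c₂])
    (p : (ℍ[k,c₁,c₂] × ℍ[k,c₁,c₂]) × (ℍ[k,c₁,c₂] × ℍ[k,c₁,c₂])) :
    (ℍ[k,c₁,c₂] × ℍ[k,c₁,c₂]) × (ℍ[k,c₁,c₂] × ℍ[k,c₁,c₂]) :=
  (p.1 + A, p.2 + B - omul β M p.1)

/-- The action of `x(A,B,M)` on lines `[m,k]` of the octonion plane. -/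
def xLn {k : Type*} [Field k] {c₁ c₂ : k} (β : k)
    (A B M : ℍ[k,c₁,c₂] × ℍ[k,c₁,c₂])
    (l : (ℍ[k,c₁,c₂] × ℍ[k,c₁,c₂]) × (ℍ[k,c₁,c₂] × ℍ[k,c₁,c₂])) :
    (ℍ[k,c₁,c₂] × ℍ[k,c₁,c₂]) × (ℍ[k,c₁,c₂] × ℍ[k,c₁,c₂]) :=
  (l.1 + M, l.2 + B + omul β l.1 A + omul β M A)

/-- The polarity on points (the coordinates of the image line `[η(conj a), -η(conj b)]`)
and on lines (the coordinates of the image point `(η(conj m), -η(conj k))`). -/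
def Ψpair {k : Type*} [Field k] {c₁ c₂ : k}
    (η : ℍ[k,c₁,c₂] × ℍ[k,c₁,c₂] → ℍ[k,c₁,c₂] × ℍ[k,c₁,c₂])
    (p : (ℍ[k,c₁,c₂] × ℍ[k,c₁,c₂]) × (ℍ[k,c₁,c₂] × ℍ[k,c₁,c₂])) :
    (ℍ[k,c₁,c₂] × ℍ[k,c₁,c₂]) × (ℍ[k,c₁,c₂] × ℍ[k,c₁,c₂]) :=
  (η (oconj p.1), -(η (oconj p.2)))

theorem omul_zero_aux {k : Type*} [Field k] {c₁ c₂ : k} (β : k)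
    (x : ℍ[k,c₁,c₂] × ℍ[k,c₁,c₂]) : omul β x 0 = 0 := by
  simp [omul]

theorem zero_omul_aux {k : Type*} [Field k] {c₁ c₂ : k} (β : k)
    (x : ℍ[k,c₁,c₂] × ℍ[k,c₁,c₂]) : omul β 0 x = 0 := by
  simp [omul]

/-- `x(A,B,M)` commutes with the polarity `Ψ` iff `A = η(conj M)` and
`η(conj B) + B + M·A = 0`. -/
theorem unipotent_commutes_with_Ψ_iff {k : Type*} [Field k] (c₁ c₂ : k) (β : k) (hβ : β ≠ 0)
    (η : ℍ[k,c₁,c₂] × ℍ[k,c₁,c₂] → ℍ[k,c₁,c₂] × ℍ[k,c₁,c₂])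
    (hbij : Function.Bijective η)
    (hadd : ∀ x y, η (x + y) = η x + η y)
    (hmul : ∀ x y, η (omul β x y) = omul β (η x) (η y))
    (hone : η ((1 : ℍ[k,c₁,c₂]), (0 : ℍ[k,c₁,c₂])) = (1, 0))
    (hinvol : ∀ x, η (η x) = x)
    (hconj : ∀ x, η (oconj x) = oconj (η x))
    (A B M : ℍ[k,c₁,c₂] × ℍ[k,c₁,c₂]) :
    ((∀ p : (ℍ[k,c₁,c₂] × ℍ[k,c₁,c₂]) × (ℍ[k,c₁,c₂] × ℍ[k,c₁,c₂]),
        Ψpair η (xPt β A B M p) = xLn β A B M (Ψpair η p)) ∧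
     (∀ l : (ℍ[k,c₁,c₂] × ℍ[k,c₁,c₂]) × (ℍ[k,c₁,c₂] × ℍ[k,c₁,c₂]),
        Ψpair η (xLn β A B M l) = xPt β A B M (Ψpair η l))) ↔
      (A = η (oconj M) ∧ η (oconj B) + B + omul β M A = 0) := by
  obtain ⟨σ, hσ⟩ : ∃ σ : ℍ[k,c₁,c₂] × ℍ[k,c₁,c₂] → ℍ[k,c₁,c₂] × ℍ[k,c₁,c₂],
      ∀ x, η (oconj x) = σ x := ⟨_, fun _ => rfl⟩
  have sadd : ∀ x y, σ (x + y) = σ x + σ y := by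
    intro x y
    simp only [← hσ, oconj_add_aux, hadd]
  have smul : ∀ x y, σ (omul β x y) = omul β (σ y) (σ x) := by
    intro x y
    simp only [← hσ, oconj_omul_aux, hmul]
  have sinv : ∀ x, σ (σ x) = x := by
    intro x
    simp only [← hσ]
    rw [← hconj, oconj_oconj_aux, hinvol]
  have s0 : σ 0 = 0 := by
    have h := sadd 0 0
    simpa using h
  have ssub : ∀ x y, σ (x - y) = σ x - σ y := by
    intro x y
    have h := sadd (x - y) y
    rw [sub_add_cancel] at h
    rw [h, add_sub_cancel_right]
  have sneg : ∀ x, σ (-x) = -σ x := by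
    intro x
    have h := ssub 0 x
    simpa [s0] using h
  simp only [Ψpair, xPt, xLn, hσ]
  constructor
  · rintro ⟨h, -⟩
    have h0 := h (0, 0)
    simp only [Prod.mk.injEq, zero_add, s0, omul_zero_aux, zero_omul_aux, sub_zero, neg_zero,
      add_zero] at h0
    obtain ⟨h1, h2⟩ := h0
    refine ⟨by rw [← h1, sinv], ?_⟩
    rw [add_assoc, ← h2, add_neg_cancel]
  · rintro ⟨rfl, h2⟩
    have h3 : omul β M (σ M) = - σ B - B := by
      rw [← sub_eq_zero, ← h2]; abel
    refine ⟨fun p => ?_, fun l => ?_⟩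
    · simp only [Prod.mk.injEq, sadd, ssub, sneg, smul, sinv, h3, true_and]
      abel
    · simp only [Prod.mk.injEq, sadd, ssub, sneg, smul, sinv, h3, true_and]
      abel
end
end

section
/- For all a, b ∈ O with b ≠ 0, one has σ(Ψ(a,b)) = Ψ(σ(a,b)); explicitly, writing Ψ(a,b) = [η(conj a), −η(conj b)] (whose second coordinate −η(conj b) is nonzero), the ordered pairs [inv(−η(conj b)) * η(conj a), inv(−η(conj b))] and [η(conj(−(a * inv b))), −η(conj(inv b))] are equal. (This expresses the paper's claim in Section 5.1 that the collineation σ : (a,b) ↦ (−a·b⁻¹, b⁻¹), [m,k] ↦ [k⁻¹·m, k⁻¹] commutes with the polarity Ψ.) -/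
noncomputable section

open Quaternion

/-- The inverse `inv x = N(x)⁻¹ • conj x` in the Cayley–Dickson double, where
`N(x₁,x₂) = n(x₁) + β·n(x₂)` and `n` is the quaternion norm. -/
def oinv {k : Type*} [Field k] {c₁ c₂ : k} (β : k) (n : ℍ[k,c₁,c₂] → k)
    (x : ℍ[k,c₁,c₂] × ℍ[k,c₁,c₂]) : ℍ[k,c₁,c₂] × ℍ[k,c₁,c₂] :=
  (n x.1 + β * n x.2)⁻¹ • oconj x

section helpers
variable {k : Type*} [Field k] {c₁ c₂ : k}

lemma oconj_oconj (x : ℍ[k,c₁,c₂] × ℍ[k,c₁,c₂]) : oconj (oconj x) = x := by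
  simp [oconj]

lemma oconj_neg (x : ℍ[k,c₁,c₂] × ℍ[k,c₁,c₂]) : oconj (-x) = -oconj x := by
  simp [oconj]

lemma oconj_smul (r : k) (x : ℍ[k,c₁,c₂] × ℍ[k,c₁,c₂]) : oconj (r • x) = r • oconj x := by
  simp [oconj, QuaternionAlgebra.star_smul]

lemma neg_omul (β : k) (x y : ℍ[k,c₁,c₂] × ℍ[k,c₁,c₂]) :
    omul β (-x) y = -omul β x y := by
  simp [omul]; constructor <;> abel

lemma omul_smul' (β r : k) (x y : ℍ[k,c₁,c₂] × ℍ[k,c₁,c₂]) :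
    omul β x (r • y) = r • omul β x y := by
  simp [omul, smul_sub, smul_comm r β]

lemma oconj_omul (β : k) (x y : ℍ[k,c₁,c₂] × ℍ[k,c₁,c₂]) :
    oconj (omul β x y) = omul β (oconj y) (oconj x) := by
  simp [omul, oconj, QuaternionAlgebra.star_smul]

variable (n : ℍ[k,c₁,c₂] → k)

lemma smul_one_inj' {r s : k} (h : r • (1 : ℍ[k,c₁,c₂]) = s • 1) : r = s := by
  simpa using congrArg QuaternionAlgebra.re h

lemma n_neg (hn : ∀ a : ℍ[k,c₁,c₂], a * star a = n a • 1 ∧ star a * a = n a • 1)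
    (a : ℍ[k,c₁,c₂]) : n (-a) = n a := by
  apply smul_one_inj' (c₁ := c₁) (c₂ := c₂)
  rw [← (hn a).1, ← (hn (-a)).1]; simp

lemma n_star (hn : ∀ a : ℍ[k,c₁,c₂], a * star a = n a • 1 ∧ star a * a = n a • 1)
    (a : ℍ[k,c₁,c₂]) : n (star a) = n a := by
  apply smul_one_inj' (c₁ := c₁) (c₂ := c₂)
  rw [← (hn a).2, ← (hn (star a)).1]; simp

lemma oconj_omul_omul
    (hn : ∀ a : ℍ[k,c₁,c₂], a * star a = n a • 1 ∧ star a * a = n a • 1)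
    (β : k) (y z : ℍ[k,c₁,c₂] × ℍ[k,c₁,c₂]) :
    omul β (oconj y) (omul β y z) = (n y.1 + β * n y.2) • z := by
  obtain ⟨y1, y2⟩ := y
  obtain ⟨z1, z2⟩ := z
  have h1 := hn y1
  have h2 := hn y2
  simp only [omul, oconj, star_star, star_neg, Prod.smul_mk, Prod.mk.injEq]
  constructor
  · have e1 : star y1 * (y1 * z1) = n y1 • z1 := by rw [← mul_assoc, h1.2]; simp
    have e2 : z1 * y2 * star y2 = n y2 • z1 := by rw [mul_assoc, h2.1]; simp
    rw [mul_sub, e1, mul_neg, add_mul, e2, mul_smul_comm, mul_assoc, add_smul, mul_smul]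
    simp only [smul_neg, smul_add]; abel
  · have e1 : y1 * (star y1 * z2) = n y1 • z2 := by rw [← mul_assoc, h1.1]; simp
    have e2 : z2 * star y2 * y2 = n y2 • z2 := by rw [mul_assoc, h2.2]; simp
    rw [mul_add, e1, mul_neg, sub_mul, smul_mul_assoc, e2, mul_assoc, add_smul, mul_smul]
    abel

lemma omul_oconj_self
    (hn : ∀ a : ℍ[k,c₁,c₂], a * star a = n a • 1 ∧ star a * a = n a • 1)
    (β : k) (y : ℍ[k,c₁,c₂] × ℍ[k,c₁,c₂]) :
    omul β y (oconj y) = (n y.1 + β * n y.2) • ((1, 0) : ℍ[k,c₁,c₂] × ℍ[k,c₁,c₂]) := by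
  obtain ⟨y1, y2⟩ := y
  simp [omul, oconj, (hn y1).1, (hn y2).1, add_smul, mul_smul]

lemma oinv_neg (hn : ∀ a : ℍ[k,c₁,c₂], a * star a = n a • 1 ∧ star a * a = n a • 1)
    (β : k) (y : ℍ[k,c₁,c₂] × ℍ[k,c₁,c₂]) : oinv β n (-y) = -oinv β n y := by
  simp [oinv, oconj_neg, n_neg n hn]

lemma oinv_oconj (hn : ∀ a : ℍ[k,c₁,c₂], a * star a = n a • 1 ∧ star a * a = n a • 1)
    (β : k) (y : ℍ[k,c₁,c₂] × ℍ[k,c₁,c₂]) : oinv β n (oconj y) = oconj (oinv β n y) := by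
  rw [oinv, oinv, oconj_smul]
  simp [oconj, n_neg n hn, n_star n hn]

lemma omul_one' (β : k) (x : ℍ[k,c₁,c₂] × ℍ[k,c₁,c₂]) : omul β x (1, 0) = x := by
  simp [omul]

end helpers

/-- the collineation `σ : (a,b) ↦ (-a·b⁻¹, b⁻¹), [m,k] ↦ [k⁻¹·m, k⁻¹]`
commutes with the polarity `Ψ` on points of the first kind. -/
theorem σ_commutes_with_Ψ {k : Type*} [Field k] (c₁ c₂ : k) (β : k) (hβ : β ≠ 0)
    (n : ℍ[k,c₁,c₂] → k)
    (hn : ∀ a : ℍ[k,c₁,c₂], a * star a = n a • 1 ∧ star a * a = n a • 1)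
    (haniso : ∀ x : ℍ[k,c₁,c₂] × ℍ[k,c₁,c₂], n x.1 + β * n x.2 = 0 → x = 0)
    (η : ℍ[k,c₁,c₂] × ℍ[k,c₁,c₂] → ℍ[k,c₁,c₂] × ℍ[k,c₁,c₂])
    (hbij : Function.Bijective η)
    (hadd : ∀ x y, η (x + y) = η x + η y)
    (hmul : ∀ x y, η (omul β x y) = omul β (η x) (η y))
    (hone : η ((1 : ℍ[k,c₁,c₂]), (0 : ℍ[k,c₁,c₂])) = (1, 0))
    (hinvol : ∀ x, η (η x) = x)
    (hconj : ∀ x, η (oconj x) = oconj (η x)) :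
    ∀ a b : ℍ[k,c₁,c₂] × ℍ[k,c₁,c₂], b ≠ 0 →
      -(η (oconj b)) ≠ 0 ∧
      (omul β (oinv β n (-(η (oconj b)))) (η (oconj a)),
          oinv β n (-(η (oconj b))))
        = (η (oconj (-(omul β a (oinv β n b)))),
            -(η (oconj (oinv β n b)))) := by
  have h0 : η 0 = 0 := by simpa using hadd 0 0
  have hneg : ∀ x, η (-x) = -η x := by
    intro x
    have h := hadd (-x) x
    rw [neg_add_cancel, h0] at h
    exact eq_neg_of_add_eq_zero_left h.symm
  have hinv : ∀ x, x ≠ 0 → oinv β n (η x) = η (oinv β n x) := by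
    intro x hx
    have hy : η x ≠ 0 := fun h => hx (by rw [← hinvol x, h, h0])
    have hNx : n x.1 + β * n x.2 ≠ 0 := fun h => hx (haniso x h)
    have hNy : n (η x).1 + β * n (η x).2 ≠ 0 := fun h => hy (haniso _ h)
    have e : omul β x (oinv β n x) = (1, 0) := by
      rw [oinv, omul_smul', omul_oconj_self n hn, smul_smul, inv_mul_cancel₀ hNx, one_smul]
    have e2 : omul β (η x) (η (oinv β n x)) = (1, 0) := by rw [← hmul, e, hone]
    have e3 := oconj_omul_omul n hn β (η x) (η (oinv β n x))
    rw [e2, omul_one'] at e3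
    conv_lhs => rw [oinv]
    rw [e3, smul_smul, inv_mul_cancel₀ hNy, one_smul]
  intro a b hb
  have hcb : oconj b ≠ 0 := fun h => hb (by
    rw [← oconj_oconj b, h]; simp [oconj])
  refine ⟨fun h => hcb ?_, ?_⟩
  · rw [← hinvol (oconj b), neg_eq_zero.mp h, h0]
  · rw [oinv_neg n hn, hinv _ hcb, oinv_oconj n hn, neg_omul, ← hmul, oconj_neg, hneg,
      oconj_omul]
end
end
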